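/- arXiv:1401.4224 — 2 statements merged into one kernel-verified Lean document; each statement's English description precedes it below -/
import Mathlib

section
/- For any transformation semigroup (X,S), there exists a surjective order-preserving map from the partial order of J-classes of S^1 (ordered by the order induced by ≤_J) onto the partial order of subduction equivalence classes of I(X) (ordered by the order induced by ⊆_S), which sends the J-class of a to the subduction class of im(a); moreover, the preimage of each subduction equivalence class under this map corresponds to a union of J-classes of S^1. -/
/-- A transformation semigroup on the state set `X`: a set of self-maps of `X`
closed under composition. With the right-action convention `x^(st) = (x^s)^t`,
the semigroup product `s * t` corresponds to the function `t ∘ s`. -/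
structure TransSgp (X : Type*) where
  carrier : Set (X → X)
  comp_mem : ∀ {s t : X → X}, s ∈ carrier → t ∈ carrier → (t ∘ s) ∈ carrier

namespace TransSgp

variable {X : Type*} (T : TransSgp X)

/-- `S¹`: the semigroup together with the identity map adjoined. -/
def S1 : Set (X → X) := insert id T.carrier

/-- The image set `I(X) = { im(s) : s ∈ S¹ }`. -/
def ImageSet : Set (Set X) := {P | ∃ s ∈ T.S1, P = Set.range s}

/-- The subduction relation: `P ⊆_S Q` iff `P ⊆ Q^s` for some `s ∈ S¹`. -/
def Subd (P Q : Set X) : Prop := ∃ s ∈ T.S1, P ⊆ s '' Q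

/-- Subduction equivalence: mutual subduction. -/
def SubdEquiv (P Q : Set X) : Prop := T.Subd P Q ∧ T.Subd Q P

/-- Green's `≤_L` preorder: `a ≤_L b` iff `a ∈ S¹ b`, i.e. `a = u·b = b ∘ u`. -/
def Lle (a b : X → X) : Prop := ∃ u ∈ T.S1, a = b ∘ u

/-- Green's `≤_J` preorder: `a ≤_J b` iff `a ∈ S¹ b S¹`, i.e. `a = u·b·v = v ∘ b ∘ u`. -/
def Jle (a b : X → X) : Prop := ∃ u ∈ T.S1, ∃ v ∈ T.S1, a = v ∘ b ∘ u

/-- Green's `L`-equivalence. -/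
def LEquiv (a b : X → X) : Prop := T.Lle a b ∧ T.Lle b a

/-- Green's `J`-equivalence. -/
def JEquiv (a b : X → X) : Prop := T.Jle a b ∧ T.Jle b a

end TransSgp

namespace TransSgp

variable {X : Type*} (T : TransSgp X)

theorem id_mem_S1 : id ∈ T.S1 := Set.mem_insert _ _

theorem comp_mem_S1 {s t : X → X} (hs : s ∈ T.S1) (ht : t ∈ T.S1) : t ∘ s ∈ T.S1 := by
  rcases hs with rfl | hs
  · exact ht
  · rcases ht with rfl | ht
    · exact Or.inr hs
    · exact Or.inr (T.comp_mem hs ht)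

theorem jle_refl (a : X → X) : T.Jle a a := ⟨id, T.id_mem_S1, id, T.id_mem_S1, rfl⟩

variable {T}

theorem Jle.trans {a b c : X → X} (hab : T.Jle a b) (hbc : T.Jle b c) : T.Jle a c := by
  obtain ⟨u, hu, v, hv, rfl⟩ := hab
  obtain ⟨u', hu', v', hv', rfl⟩ := hbc
  exact ⟨u' ∘ u, T.comp_mem_S1 hu hu', v ∘ v', T.comp_mem_S1 hv' hv, rfl⟩

theorem Jle.subd_range {a b : X → X} (h : T.Jle a b) : T.Subd (Set.range a) (Set.range b) := by
  obtain ⟨u, -, v, hv, rfl⟩ := h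
  refine ⟨v, hv, ?_⟩
  rintro _ ⟨x, rfl⟩
  exact ⟨b (u x), ⟨u x, rfl⟩, rfl⟩

theorem JEquiv.subdEquiv_range {a b : X → X} (h : T.JEquiv a b) :
    T.SubdEquiv (Set.range a) (Set.range b) :=
  ⟨h.1.subd_range, h.2.subd_range⟩

variable (T)

theorem subd_refl (P : Set X) : T.Subd P P := ⟨id, T.id_mem_S1, (Set.image_id P).ge⟩

variable {T}

theorem Subd.trans {P Q R : Set X} (hPQ : T.Subd P Q) (hQR : T.Subd Q R) : T.Subd P R := by
  obtain ⟨s, hs, hP⟩ := hPQ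
  obtain ⟨t, ht, hQ⟩ := hQR
  refine ⟨s ∘ t, T.comp_mem_S1 ht hs, hP.trans ?_⟩
  rw [Set.image_comp]
  exact Set.image_mono hQ

variable (T)

theorem jEquiv_equivalence : Equivalence T.JEquiv where
  refl a := ⟨T.jle_refl a, T.jle_refl a⟩
  symm h := ⟨h.2, h.1⟩
  trans h k := ⟨h.1.trans k.1, k.2.trans h.2⟩

theorem subdEquiv_equivalence : Equivalence T.SubdEquiv where
  refl P := ⟨T.subd_refl P, T.subd_refl P⟩
  symm h := ⟨h.2, h.1⟩
  trans h k := ⟨h.1.trans k.1, k.2.trans h.2⟩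

end TransSgp

/-- For any transformation semigroup `(X,S)` with `X` finite, there is a
surjective order-preserving map from the partial order of `J`-classes of `S¹` onto the
partial order of subduction classes of `I(X)`, sending the `J`-class of `a` to the
subduction class of `im(a)`; the preimage of each subduction class corresponds to a
union of `J`-classes. -/
theorem Jclasses_onto_skeleton {X : Type*} [Finite X] (T : TransSgp X) :
    ∃ (eJ : Equivalence fun a b : T.S1 => T.JEquiv a.1 b.1)
      (eS : Equivalence fun P Q : T.ImageSet => T.SubdEquiv P.1 Q.1),
      let sJ : Setoid T.S1 := ⟨fun a b => T.JEquiv a.1 b.1, eJ⟩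
      let sS : Setoid T.ImageSet := ⟨fun P Q => T.SubdEquiv P.1 Q.1, eS⟩
      let rJ : Quotient sJ → Quotient sJ → Prop := fun x y =>
        ∃ a b : T.S1, x = Quotient.mk sJ a ∧ y = Quotient.mk sJ b ∧ T.Jle a.1 b.1
      let rS : Quotient sS → Quotient sS → Prop := fun x y =>
        ∃ P Q : T.ImageSet, x = Quotient.mk sS P ∧ y = Quotient.mk sS Q ∧ T.Subd P.1 Q.1
      ∃ F : Quotient sJ → Quotient sS,
        (∀ a : T.S1, F (Quotient.mk sJ a) = Quotient.mk sS ⟨Set.range a.1, a.1, a.2, rfl⟩) ∧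
        Function.Surjective F ∧
        (∀ x y : Quotient sJ, rJ x y → rS (F x) (F y)) ∧
        (∀ c : Quotient sS, ∃ C : Set (Set T.S1),
          (∀ cl ∈ C, ∃ a : T.S1, cl = {b : T.S1 | T.JEquiv a.1 b.1}) ∧
          {a : T.S1 | F (Quotient.mk sJ a) = c} = ⋃₀ C) := by
  refine ⟨T.jEquiv_equivalence.comap Subtype.val, T.subdEquiv_equivalence.comap Subtype.val, ?_⟩
  intro sJ sS rJ rS
  let F : Quotient sJ → Quotient sS :=
    Quotient.map (fun a => ⟨Set.range a.1, a.1, a.2, rfl⟩)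
      fun _ _ h => TransSgp.JEquiv.subdEquiv_range h
  refine ⟨F, fun _ => rfl, ?_, ?_, ?_⟩
  · intro c
    induction c using Quotient.inductionOn with
    | h P =>
      obtain ⟨_, s, hs, rfl⟩ := P
      exact ⟨Quotient.mk sJ ⟨s, hs⟩, rfl⟩
  · rintro _ _ ⟨a, b, rfl, rfl, h⟩
    exact ⟨_, _, rfl, rfl, h.subd_range⟩
  · intro c
    refine ⟨{cl | ∃ a : T.S1, F (Quotient.mk sJ a) = c ∧ cl = {b : T.S1 | T.JEquiv a.1 b.1}},
      fun _ ⟨a, _, ha⟩ => ⟨a, ha⟩, Set.ext fun a => ⟨fun ha => ?_, ?_⟩⟩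
    · exact ⟨_, ⟨a, ha, rfl⟩, T.jEquiv_equivalence.refl a.1⟩
    · rintro ⟨_, ⟨b, hb, rfl⟩, hab⟩
      have hq : Quotient.mk sJ b = Quotient.mk sJ a := Quotient.sound hab
      exact (congrArg F hq).symm.trans hb
end

section
/- There exists a finite transformation monoid (X,S) and elements a, b ∈ S such that a and b are ≤_J-incomparable (neither a ≤_J b nor b ≤_J a holds) and yet im(a) is strictly subduced below im(b) (im(a) ⊆_S im(b) but not im(b) ⊆_S im(a)). In particular, the map from the J-class order to the subduction class order can introduce strictly new order relations, so the subduction class order is not merely a quotient collapsing of the J-class order. (A witness: X = {1,2,3,4,5}, S the monoid generated by a sending (1,2,3,4,5) to (2,1,1,1,4) and b sending (1,2,3,4,5) to (1,2,2,3,4).) -/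
/-- The null monoid `{1, a, b, 0}` with `a = [0,0,0,1,0]` and `b = [0,0,0,1,2]`, acting on
`{0,…,4}`: all products of non-identity elements are the constant map `0`. -/
def nullMonoid : TransSgp (Fin 5) where
  carrier := {id, ![0, 0, 0, 1, 0], ![0, 0, 0, 1, 2], ![0, 0, 0, 0, 0]}
  comp_mem := by
    rintro s t (rfl | rfl | rfl | rfl) (rfl | rfl | rfl | rfl) <;>
      simp only [Set.mem_insert_iff, Set.mem_singleton_iff] <;> decide

theorem nullMonoid_S1 :
    nullMonoid.S1 = {id, ![0, 0, 0, 1, 0], ![0, 0, 0, 1, 2], ![0, 0, 0, 0, 0]} :=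
  Set.insert_eq_of_mem (Or.inl rfl)

/-- There is a finite transformation monoid `(X,S)` and elements
`a, b ∈ S` that are `≤_J`-incomparable while `im(a)` is strictly subduced below `im(b)`:
`im(a) ⊆_S im(b)` but not `im(b) ⊆_S im(a)`. Hence the subduction class order can
contain strictly new relations beyond those induced from the `J`-class order.
(A witness: `X = {1,…,5}`, `S = ⟨a, b⟩` with `a = [2,1,1,1,4]`, `b = [1,2,2,3,4]`.) -/
theorem exists_Jincomparable_strict_subduction :
    ∃ (X : Type) (_ : Fintype X) (T : TransSgp X) (a b : X → X),
      id ∈ T.carrier ∧ a ∈ T.carrier ∧ b ∈ T.carrier ∧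
      ¬ T.Jle a b ∧ ¬ T.Jle b a ∧
      T.Subd (Set.range a) (Set.range b) ∧ ¬ T.Subd (Set.range b) (Set.range a) := by
  refine ⟨Fin 5, inferInstance, nullMonoid, ![0, 0, 0, 1, 0], ![0, 0, 0, 1, 2],
    Or.inl rfl, Or.inr (Or.inl rfl), Or.inr (Or.inr (Or.inl rfl)), ?_, ?_, ?_, ?_⟩ <;>
    simp only [TransSgp.Jle, TransSgp.Subd, nullMonoid_S1]
  · rintro ⟨u, rfl | rfl | rfl | rfl, v, rfl | rfl | rfl | rfl, h⟩ <;> revert h <;> decide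
  · rintro ⟨u, rfl | rfl | rfl | rfl, v, rfl | rfl | rfl | rfl, h⟩ <;> revert h <;> decide
  · refine ⟨id, Or.inl rfl, ?_⟩
    rw [Set.image_id]
    rintro _ ⟨x, rfl⟩
    revert x
    simp only [Set.mem_range]
    decide
  · rintro ⟨s, hs, h⟩
    obtain ⟨_, ⟨x, rfl⟩, hx⟩ := h ⟨4, rfl⟩
    rcases hs with rfl | rfl | rfl | rfl <;> revert hx x <;> decide
end
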